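/- Let n be a positive integer with 4 dividing n(n+1)/2, and let p_1 ≤ p_2 ≤ p_3 ≤ p_4 be positive integers with p_1+p_2+p_3+p_4 = n satisfying condition (★) with k = 4. If there is no equitable partition of [n] implementing (p_1,p_2,p_3,p_4), then there exists a minimal partition of [n] implementing (p_1,p_2,p_3,p_4) of finite width, i.e. containing elements x < y with x in a low set and y in a high set. -/

import Mathlib

open Finset

/-- `s^{n,k} = (n(n+1)/2)/k`. -/
def magicConst (n k : ℕ) : ℕ := (n * (n + 1) / 2) / k

/-- `A` is a partition of `[n] = {1,…,n}` into `k` (indexed) parts. -/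
def IsPartitionOn (n : ℕ) {k : ℕ} (A : Fin k → Finset ℕ) : Prop :=
  (∀ i j : Fin k, i ≠ j → Disjoint (A i) (A j)) ∧
    Finset.univ.biUnion A = Finset.Icc 1 n

/-- The partition `A` of `[n]` implements the sequence of sizes `p` (up to reindexing). -/
def Implements (n : ℕ) {k : ℕ} (A : Fin k → Finset ℕ) (p : Fin k → ℕ) : Prop :=
  IsPartitionOn n A ∧ ∃ e : Equiv.Perm (Fin k), ∀ i, (A (e i)).card = p i

/-- Every part of the partition has sum `s^{n,k}`. -/
def Equitable (n : ℕ) {k : ℕ} (A : Fin k → Finset ℕ) : Prop :=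
  ∀ i, (A i).sum id = magicConst n k

/-- `d(A) = Σ_i (S(A_i) − s^{n,k})²`. -/
def dVal (n : ℕ) {k : ℕ} (A : Fin k → Finset ℕ) : ℤ :=
  ∑ i : Fin k, ((((A i).sum id : ℕ) : ℤ) - (magicConst n k : ℤ)) ^ 2

/-- A partition implementing `p` minimizing `d` among all partitions implementing `p`. -/
def MinimalPartition (n : ℕ) {k : ℕ} (A : Fin k → Finset ℕ) (p : Fin k → ℕ) : Prop :=
  Implements n A p ∧ ∀ B : Fin k → Finset ℕ, Implements n B p → dVal n A ≤ dVal n B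

/-- Condition (★): `Σ_{i=1}^{P_j} (n−i+1) ≥ j·s^{n,k}` for all `j = 1,…,k`,
where `P_j = p_1 + ⋯ + p_j`. -/
def StarCond (n k : ℕ) (p : Fin k → ℕ) : Prop :=
  ∀ j : Fin k,
    ((j : ℕ) + 1) * magicConst n k ≤ ∑ i ∈ Finset.range (∑ t ∈ Finset.Iic j, p t), (n - i)

/-- The width `ω(A)` of a partition: the minimum of `y − x` over pairs `x < y` with `x`
in a low set and `y` in a high set (`⊤` if there is no such pair). -/
noncomputable def width (n : ℕ) {k : ℕ} (A : Fin k → Finset ℕ) : ℕ∞ :=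
  sInf { w : ℕ∞ | ∃ (x y : ℕ) (i j : Fin k), x ∈ A i ∧ y ∈ A j ∧ x < y ∧
    (A i).sum id < magicConst n k ∧ magicConst n k < (A j).sum id ∧ w = (y - x : ℕ) }

/-- The deviation of the sum of the part `A i` from the magic constant. -/
def deviation (n : ℕ) {k : ℕ} (A : Fin k → Finset ℕ) (i : Fin k) : ℤ :=
  (((A i).sum id : ℕ) : ℤ) - (magicConst n k : ℤ)

/-- Exchange the elements `a` and `a + 1` in a family of sets. -/
def adjSwap {k : ℕ} (A : Fin k → Finset ℕ) (a : ℕ) : Fin k → Finset ℕ :=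
  fun t => (A t).map (Equiv.swap a (a + 1)).toEmbedding

/-- Some element of a low set is smaller than some element of a high set. -/
def HasFiniteWidth (n : ℕ) {k : ℕ} (A : Fin k → Finset ℕ) : Prop :=
  ∃ (x y : ℕ) (i j : Fin k), x ∈ A i ∧ y ∈ A j ∧ x < y ∧
    (A i).sum id < magicConst n k ∧ magicConst n k < (A j).sum id

section

variable {n k : ℕ} {A : Fin k → Finset ℕ} {p : Fin k → ℕ}

theorem mem_adjSwap {a z : ℕ} {t : Fin k} :
    z ∈ adjSwap A a t ↔ Equiv.swap a (a + 1) z ∈ A t := by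
  simp [adjSwap, Finset.mem_map_equiv]

theorem mem_adjSwap_of_ne {a z : ℕ} {t : Fin k} (h₁ : z ≠ a) (h₂ : z ≠ a + 1) :
    z ∈ adjSwap A a t ↔ z ∈ A t := by
  rw [mem_adjSwap, Equiv.swap_apply_of_ne_of_ne h₁ h₂]

theorem IsPartitionOn.eq_of_mem (h : IsPartitionOn n A) {z : ℕ} {i j : Fin k}
    (hi : z ∈ A i) (hj : z ∈ A j) : i = j := by
  by_contra hij
  exact Finset.disjoint_left.mp (h.1 i j hij) hi hj

theorem IsPartitionOn.exists_mem_iff (h : IsPartitionOn n A) {z : ℕ} :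
    (∃ i, z ∈ A i) ↔ 1 ≤ z ∧ z ≤ n := by
  rw [← Finset.mem_Icc, ← h.2]
  simp

theorem IsPartitionOn.adjSwap (h : IsPartitionOn n A) {a : ℕ} (ha : 1 ≤ a) (han : a + 1 ≤ n) :
    IsPartitionOn n (adjSwap A a) := by
  refine ⟨fun i j hij => ?_, ?_⟩
  · rw [Finset.disjoint_left]
    intro z hi hj
    exact hij (h.eq_of_mem (mem_adjSwap.mp hi) (mem_adjSwap.mp hj))
  · ext z
    simp only [Finset.mem_biUnion, Finset.mem_univ, true_and, mem_adjSwap, h.exists_mem_iff,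
      Finset.mem_Icc]
    rw [Equiv.swap_apply_def]
    split_ifs <;> omega

theorem Implements.adjSwap (h : Implements n A p) {a : ℕ} {i j : Fin k} (hi : a ∈ A i)
    (hj : a + 1 ∈ A j) : Implements n (adjSwap A a) p := by
  obtain ⟨hA, e, he⟩ := h
  exact ⟨hA.adjSwap (hA.exists_mem_iff.mp ⟨i, hi⟩).1 (hA.exists_mem_iff.mp ⟨j, hj⟩).2,
    e, fun t => by simp [_root_.adjSwap, he]⟩

theorem deviation_adjSwap (h : IsPartitionOn n A) {a : ℕ} {i j : Fin k} (hi : a ∈ A i)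
    (hj : a + 1 ∈ A j) (t : Fin k) :
    deviation n (adjSwap A a) t =
      deviation n A t + (if t = i then 1 else 0) - (if t = j then 1 else 0) := by
  have hi' : t = i ↔ a ∈ A t := ⟨fun e => e ▸ hi, fun e => h.eq_of_mem e hi⟩
  have hj' : t = j ↔ a + 1 ∈ A t := ⟨fun e => e ▸ hj, fun e => h.eq_of_mem e hj⟩
  have key : ∀ z : ℕ, ((Equiv.swap a (a + 1) z : ℕ) : ℤ) =
      z + (if z = a then 1 else 0) - (if z = a + 1 then 1 else 0) := by
    intro z
    rw [Equiv.swap_apply_def]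
    split_ifs <;> omega
  simp only [deviation, adjSwap, Finset.sum_map, id, Equiv.coe_toEmbedding, hi', hj']
  push_cast
  simp only [key, Finset.sum_sub_distrib, Finset.sum_add_distrib, Finset.sum_ite_eq']
  ring

theorem dVal_adjSwap (h : IsPartitionOn n A) {a : ℕ} {i j : Fin k} (hi : a ∈ A i)
    (hj : a + 1 ∈ A j) (hij : i ≠ j) :
    dVal n (adjSwap A a) = dVal n A + 2 * (deviation n A i - deviation n A j) + 2 := by
  have hd : ∀ B : Fin k → Finset ℕ, dVal n B = ∑ t, deviation n B t ^ 2 := fun _ => rfl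
  have key : ∀ t, deviation n (adjSwap A a) t ^ 2 = deviation n A t ^ 2 +
      (if t = i then 2 * deviation n A t + 1 else 0) -
      (if t = j then 2 * deviation n A t - 1 else 0) := by
    intro t
    rw [deviation_adjSwap h hi hj]
    split_ifs with h₁ h₂
    · exact absurd (h₁.symm.trans h₂) hij
    all_goals ring
  rw [hd, hd, Finset.sum_congr rfl fun t _ => key t]
  simp only [Finset.sum_sub_distrib, Finset.sum_add_distrib, Finset.sum_ite_eq',
    Finset.mem_univ, if_true]
  ring

/-- The first `j + 1` terms of a monotone sequence have the least sum among all families of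
`j + 1` terms. -/
theorem sum_Iic_le_sum_of_card (hp : Monotone p) (j : Fin k) (J : Finset (Fin k))
    (hJ : J.card = (j : ℕ) + 1) : ∑ t ∈ Finset.Iic j, p t ≤ ∑ t ∈ J, p t := by
  have hc : (Finset.Iic j \ J).card = (J \ Finset.Iic j).card := by
    apply Finset.card_sdiff_comm
    rw [Fin.card_Iic, hJ]
  rw [← Finset.sum_sdiff_le_sum_sdiff]
  calc ∑ t ∈ Finset.Iic j \ J, p t ≤ (Finset.Iic j \ J).card • p j :=
        Finset.sum_le_card_nsmul _ _ _ fun t ht => hp (by simp at ht; exact ht.1)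
    _ = (J \ Finset.Iic j).card • p j := by rw [hc]
    _ ≤ ∑ t ∈ J \ Finset.Iic j, p t :=
        Finset.card_nsmul_le_sum _ _ _ fun t ht => hp (by simp at ht; exact ht.2.le)

/-- An upward closed subset of `[n]` with at least `q` elements contains the `q` largest elements
of `[n]`. -/
theorem sum_range_sub_le_sum_of_upward_closed {U : Finset ℕ} {q : ℕ} (hU : U ⊆ Finset.Icc 1 n)
    (hup : ∀ z ∈ U, z + 1 ≤ n → z + 1 ∈ U) (hq : q ≤ U.card) :
    ∑ i ∈ Finset.range q, (n - i) ≤ U.sum id := by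
  have hqn : q ≤ n := hq.trans (by simpa using Finset.card_le_card hU)
  have hup' : ∀ z ∈ U, ∀ w, z ≤ w → w ≤ n → w ∈ U := by
    intro z hz w hzw
    induction w, hzw using Nat.le_induction with
    | base => exact fun _ => hz
    | succ w _ ih => exact fun h => hup w (ih (by omega)) h
  have hinj : Set.InjOn (fun i => n - i) (Finset.range q : Set ℕ) := by
    intro x hx y hy hxy
    simp at hx hy hxy
    omega
  have hsub : (Finset.range q).image (fun i => n - i) ⊆ U := by
    intro t ht
    obtain ⟨i, hi, rfl⟩ := Finset.mem_image.mp ht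
    by_contra hnot
    have hsub : U ⊆ Finset.Ioc (n - i) n := by
      intro u hu
      have hu' := Finset.mem_Icc.mp (hU hu)
      refine Finset.mem_Ioc.mpr ⟨?_, hu'.2⟩
      by_contra hle
      exact hnot (hup' u hu _ (by omega) (by omega))
    have := Finset.card_le_card hsub
    simp at this hi
    omega
  calc ∑ i ∈ Finset.range q, (n - i)
      = ((Finset.range q).image (fun i => n - i)).sum id :=
        (Finset.sum_image (f := id) hinj).symm
    _ ≤ U.sum id := Finset.sum_le_sum_of_subset hsub

/-- Under the condition (★), a subfamily of parts whose total deviation is negative cannot occupy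
the top of `[n]`. -/
theorem exists_succ_mem_of_sum_deviation_neg (h : Implements n A p) (hp : Monotone p)
    (hstar : StarCond n k p) {J : Finset (Fin k)} (hlt : ∑ t ∈ J, deviation n A t < 0) :
    ∃ a, ∃ i ∈ J, ∃ j ∉ J, a ∈ A i ∧ a + 1 ∈ A j := by
  by_contra! hno
  obtain ⟨hA, e, he⟩ := h
  have hJ : 0 < J.card := by
    rw [Finset.card_pos, Finset.nonempty_iff_ne_empty]
    rintro rfl
    simp at hlt
  have hJk : J.card ≤ k := by simpa using Finset.card_le_univ J
  have hdisj : Set.PairwiseDisjoint (J : Set (Fin k)) A := fun i _ j _ hij => hA.1 i j hij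
  have hcard : (J.biUnion A).card = ∑ t ∈ J.map e.symm.toEmbedding, p t := by
    rw [Finset.card_biUnion hdisj, Finset.sum_map]
    exact Finset.sum_congr rfl fun t _ => by simp [← he]
  have hle := sum_Iic_le_sum_of_card hp ⟨J.card - 1, by omega⟩ (J.map e.symm.toEmbedding)
    (by simp; omega)
  rw [← hcard] at hle
  have hsum := sum_range_sub_le_sum_of_upward_closed (n := n) (U := J.biUnion A) ?_ ?_ hle
  · have hs := (hstar ⟨J.card - 1, by omega⟩).trans hsum
    rw [Finset.sum_biUnion hdisj] at hs
    simp only [Nat.sub_add_cancel hJ] at hs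
    simp only [deviation, Finset.sum_sub_distrib, Finset.sum_const, nsmul_eq_mul] at hlt
    zify at hs
    push_cast at hlt hs
    linarith
  · rw [← hA.2]
    exact Finset.biUnion_subset_biUnion_of_subset_left _ (Finset.subset_univ _)
  · intro z hz hzn
    obtain ⟨i, hi, hzi⟩ := Finset.mem_biUnion.mp hz
    obtain ⟨j, hj⟩ := hA.exists_mem_iff.mpr ⟨Nat.le_add_left 1 z, hzn⟩
    by_cases hjJ : j ∈ J
    · exact Finset.mem_biUnion.mpr ⟨j, hjJ, hj⟩
    · exact absurd hj (hno z i hi j hjJ hzi)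

theorem HasFiniteWidth.of_deviation {x y : ℕ} {i j : Fin k} (hx : x ∈ A i) (hy : y ∈ A j)
    (hxy : x < y) (hi : deviation n A i < 0) (hj : 0 < deviation n A j) : HasFiniteWidth n A := by
  unfold deviation at hi hj
  exact ⟨x, y, i, j, hx, hy, hxy, by omega, by omega⟩

theorem MinimalPartition.of_dVal_eq {B : Fin k → Finset ℕ} (h : MinimalPartition n A p)
    (hB : Implements n B p) (hd : dVal n B = dVal n A) : MinimalPartition n B p :=
  ⟨hB, fun C hC => hd ▸ h.2 C hC⟩

/-- In a minimal partition, an adjacent inversion between parts of different deviation forces the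
deviations to differ by exactly one, and exchanging the two elements gives a minimal partition. -/
theorem MinimalPartition.adjSwap (h : MinimalPartition n A p) {a : ℕ} {i j : Fin k}
    (hi : a ∈ A i) (hj : a + 1 ∈ A j) (hlt : deviation n A i < deviation n A j) :
    deviation n A j = deviation n A i + 1 ∧ MinimalPartition n (adjSwap A a) p := by
  have hij : i ≠ j := by rintro rfl; exact lt_irrefl _ hlt
  have hB := h.1.adjSwap hi hj
  have hd := dVal_adjSwap h.1.1 hi hj hij
  have hle := h.2 _ hB
  exact ⟨by omega, h.of_dVal_eq hB (by omega)⟩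

theorem exists_minimalPartition (h : ∃ A : Fin k → Finset ℕ, Implements n A p) :
    ∃ A : Fin k → Finset ℕ, MinimalPartition n A p := by
  let S : Set (Fin k → Finset ℕ) := {A | Implements n A p}
  have hS : S.Nonempty := h
  refine ⟨Function.argminOn (fun A => (dVal n A).toNat) S hS,
    Function.argminOn_mem (fun A => (dVal n A).toNat) S hS, fun B hB => ?_⟩
  have hle := Function.argminOn_le (fun A => (dVal n A).toNat) S (a := B) hB
  have hnn : ∀ C : Fin k → Finset ℕ, 0 ≤ dVal n C :=
    fun C => Finset.sum_nonneg fun _ _ => sq_nonneg _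
  have := hnn B
  omega

end

theorem exists_implements {n : ℕ} {p : Fin 4 → ℕ} (hsum : ∑ i : Fin 4, p i = n) :
    ∃ A : Fin 4 → Finset ℕ, Implements n A p := by
  rw [Fin.sum_univ_four] at hsum
  refine ⟨![Finset.Ioc 0 (p 0), Finset.Ioc (p 0) (p 0 + p 1),
    Finset.Ioc (p 0 + p 1) (p 0 + p 1 + p 2), Finset.Ioc (p 0 + p 1 + p 2) n],
    ⟨fun i j hij => ?_, ?_⟩, Equiv.refl _, fun i => ?_⟩
  · rw [Finset.disjoint_left]
    intro z
    fin_cases i <;> fin_cases j <;> simp at hij ⊢ <;> omega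
  · ext z
    simp [Fin.exists_fin_succ]
    omega
  · fin_cases i <;> simp
    omega

theorem sum_deviation_eq_zero {n k : ℕ} {A : Fin k → Finset ℕ} (h : IsPartitionOn n A)
    (hdvd : k ∣ n * (n + 1) / 2) : ∑ t, deviation n A t = 0 := by
  have h₁ : ∑ t, (A t).sum id = n * (n + 1) / 2 := by
    rw [← Finset.sum_biUnion fun i _ j _ hij => h.1 i j hij, h.2]
    have := Finset.sum_range_id_mul_two (n + 1)
    rw [Finset.range_eq_Ico, Finset.sum_eq_sum_Ico_succ_bot (Nat.succ_pos n)] at this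
    have hIcc : Finset.Ico (0 + 1) (n + 1) = Finset.Icc 1 n := rfl
    rw [hIcc] at this
    simp only [id, Nat.add_sub_cancel] at this ⊢
    rw [Nat.mul_comm n]
    omega
  have h₂ : k * magicConst n k = n * (n + 1) / 2 := Nat.mul_div_cancel' hdvd
  simp only [deviation, Finset.sum_sub_distrib, Finset.sum_const, nsmul_eq_mul,
    Finset.card_univ, Fintype.card_fin]
  rw [← Nat.cast_sum, h₁, ← h₂]
  push_cast
  ring


/-- Lemma 5: existence of a minimal partition of finite width. -/
theorem stmt_12 (n : ℕ) (hn : 0 < n) (hdvd : 4 ∣ n * (n + 1) / 2)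
    (p : Fin 4 → ℕ) (hp : ∀ i, 0 < p i) (hmono : Monotone p)
    (hsum : ∑ i : Fin 4, p i = n) (hstar : StarCond n 4 p)
    (hne : ¬ ∃ B : Fin 4 → Finset ℕ, Implements n B p ∧ Equitable n B) :
    ∃ A : Fin 4 → Finset ℕ, MinimalPartition n A p ∧
      ∃ (x y : ℕ) (i j : Fin 4), x ∈ A i ∧ y ∈ A j ∧ x < y ∧
        (A i).sum id < magicConst n 4 ∧ magicConst n 4 < (A j).sum id := by
  by_contra hcon
  have hno : ∀ A : Fin 4 → Finset ℕ, MinimalPartition n A p → ¬ HasFiniteWidth n A :=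
    fun A hA hw => hcon ⟨A, hA, hw⟩
  obtain ⟨A, hA⟩ := exists_minimalPartition (exists_implements hsum)
  have hpart := hA.1.1
  have hzero := sum_deviation_eq_zero hpart hdvd
  have hsep : ∀ {x y i j}, x ∈ A i → y ∈ A j → deviation n A i < 0 → 0 < deviation n A j →
      y ≤ x := by
    intro x y i j hx hy hi hj
    by_contra hlt
    exact hno A hA (.of_deviation hx hy (by omega) hi hj)
  have hnonzero : ∃ t, deviation n A t ≠ 0 := by
    by_contra! hall
    refine hne ⟨A, hA.1, fun i => ?_⟩
    have := hall i
    unfold deviation at this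
    omega
  have hlow : ∃ t, deviation n A t < 0 := by
    by_contra! hall
    obtain ⟨t, ht⟩ := hnonzero
    exact ht ((Finset.sum_eq_zero_iff_of_nonneg fun i _ => hall i).mp hzero t (Finset.mem_univ t))
  obtain ⟨l, hl⟩ := hlow
  -- an element of a low part whose successor lies in an exact part
  obtain ⟨a, i, hi, j, hj, hai, haj⟩ := exists_succ_mem_of_sum_deviation_neg hA.1 hmono hstar
    (J := Finset.univ.filter fun t => deviation n A t < 0)
    (Finset.sum_neg (fun t ht => (Finset.mem_filter.mp ht).2) ⟨l, by simpa using hl⟩)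
  simp only [Finset.mem_filter, Finset.mem_univ, true_and, not_lt] at hi hj
  replace hj : deviation n A j = 0 := by
    by_contra hne0
    have := hsep hai haj hi (by omega)
    omega
  -- an element of an exact part whose successor lies in a high part
  obtain ⟨b, i', hi', j', hj', hbi, hbj⟩ := exists_succ_mem_of_sum_deviation_neg hA.1 hmono hstar
    (J := Finset.univ.filter fun t => deviation n A t ≤ 0)
    (Finset.sum_neg' (fun t ht => (Finset.mem_filter.mp ht).2) ⟨l, by simpa using hl.le, hl⟩)
  simp only [Finset.mem_filter, Finset.mem_univ, true_and, not_le] at hi' hj'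
  replace hi' : deviation n A i' = 0 := by
    by_contra hne0
    have := hsep hbi hbj (by omega) hj'
    omega
  -- an exact part reached from a low part lies entirely above all high parts
  have habove : ∀ {x u v z w y}, x ∈ A u → x + 1 ∈ A v → deviation n A u < 0 →
      deviation n A v = 0 → z ∈ A v → y ∈ A w → 0 < deviation n A w → y ≤ z := by
    intro x u v z w y hxu hxv hu hv hz hy hw
    by_contra hlt
    have hyx := hsep hxu hy hu hw
    obtain ⟨-, hm⟩ := hA.adjSwap hxu hxv (by omega)
    have hwu : w ≠ u := by rintro rfl; omega
    have hwv : w ≠ v := by rintro rfl; omega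
    have huv : v ≠ u := by rintro rfl; omega
    have hyx' : y ≠ x := by rintro rfl; exact hwu (hpart.eq_of_mem hy hxu)
    refine hno _ hm (.of_deviation (x := z) (y := y) (i := v) (j := w) ?_ ?_ (by omega) ?_ ?_)
    · rwa [mem_adjSwap_of_ne (by omega) (by omega)]
    · rwa [mem_adjSwap_of_ne (by omega) (by omega)]
    · rw [deviation_adjSwap hpart hxu hxv]
      simp [huv, hv]
    · rw [deviation_adjSwap hpart hxu hxv]
      simpa [hwu, hwv] using hw
  -- an exact part reaching a high part lies entirely below all low parts
  have hbelow : ∀ {y z}, y ∈ A i → z ∈ A i' → z ≤ y := by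
    intro y z hy hz
    by_contra hlt
    have hby := hsep hy hbj hi hj'
    obtain ⟨-, hm⟩ := hA.adjSwap hbi hbj (by omega)
    have h₁ : i ≠ i' := by rintro rfl; omega
    have h₂ : i ≠ j' := by rintro rfl; omega
    have h₃ : i' ≠ j' := by rintro rfl; omega
    have hyb : y ≠ b + 1 := by rintro rfl; exact h₂ (hpart.eq_of_mem hy hbj)
    refine hno _ hm (.of_deviation (x := y) (y := z) (i := i) (j := i') ?_ ?_ (by omega) ?_ ?_)
    · rwa [mem_adjSwap_of_ne (by omega) (by omega)]
    · rwa [mem_adjSwap_of_ne (by omega) (by omega)]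
    · rw [deviation_adjSwap hpart hbi hbj]
      simpa [h₁, h₂] using hi
    · rw [deviation_adjSwap hpart hbi hbj]
      simp [h₃, hi']
  have hji' : j ≠ i' := by
    rintro rfl
    have := habove hai haj hi hj hbi hbj hj'
    omega
  have hij : i ≠ j := by rintro rfl; omega
  have hii' : i ≠ i' := by rintro rfl; omega
  have hij' : i ≠ j' := by rintro rfl; omega
  have hjj' : j ≠ j' := by rintro rfl; omega
  have hi'j' : i' ≠ j' := by rintro rfl; omega
  have hcover : ∀ t, t = i ∨ t = j ∨ t = i' ∨ t = j' := by omega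
  obtain ⟨hdi, -⟩ := hA.adjSwap hai haj (by omega)
  obtain ⟨e, u, hu, v, hv, heu, hev⟩ := exists_succ_mem_of_sum_deviation_neg hA.1 hmono hstar
    (J := {i, j}) (by rw [Finset.sum_pair hij]; omega)
  simp only [Finset.mem_insert, Finset.mem_singleton, not_or] at hu hv
  have hv' : v = i' ∨ v = j' := by
    rcases hcover v with h | h | h | h
    · exact absurd h hv.1
    · exact absurd h hv.2
    · exact Or.inl h
    · exact Or.inr h
  rcases hu with rfl | rfl <;> rcases hv' with rfl | rfl
  · have := habove heu hev hi hi' hbi hbj hj'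
    omega
  · have := hsep heu hev hi hj'
    omega
  -- both exact parts interleave: exchange across them and then with the low part
  · have hea := hbelow hai hev
    have hea' : e + 1 ≠ a := by rintro rfl; exact hii' (hpart.eq_of_mem hai hev)
    have hbe := habove hai haj hi hj heu hbj hj'
    have hbe' : b + 1 ≠ e := by rintro rfl; exact hjj' (hpart.eq_of_mem heu hbj)
    have hB := hA.1.adjSwap heu hev
    have hBd := dVal_adjSwap hpart heu hev hji'
    have hBdev := deviation_adjSwap hpart heu hev
    have hai₁ : a ∈ adjSwap A e i := by rwa [mem_adjSwap_of_ne (by omega) (by omega)]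
    have haj₁ : a + 1 ∈ adjSwap A e u := by rwa [mem_adjSwap_of_ne (by omega) (by omega)]
    have hC := hB.adjSwap hai₁ haj₁
    have hCd := dVal_adjSwap hB.1 hai₁ haj₁ hij
    have hCdev := deviation_adjSwap hB.1 hai₁ haj₁
    have hm : MinimalPartition n (adjSwap (adjSwap A e) a) p := by
      refine hA.of_dVal_eq hC ?_
      rw [hCd, hBd, hBdev, hBdev]
      simp [hij, hii', hji']
      omega
    refine hno _ hm (.of_deviation (x := b) (y := b + 1) (i := v) (j := j') ?_ ?_ (by omega) ?_ ?_)
    · rwa [mem_adjSwap_of_ne (by omega) (by omega), mem_adjSwap_of_ne (by omega) (by omega)]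
    · rwa [mem_adjSwap_of_ne (by omega) (by omega), mem_adjSwap_of_ne (by omega) (by omega)]
    · rw [hCdev, hBdev]
      simp [hii'.symm, hji'.symm, hi']
    · rw [hCdev, hBdev]
      simpa [hij'.symm, hjj'.symm, hi'j'.symm] using hj'
  · have := habove hai haj hi hj heu hev hj'
    omega
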